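/- If weights are degree-monotone in a generating tuple ⟨μ,d⟩ and H ∈ ℛℋ(μ,d) is a directed Huffman tree, then for every directed tree T ∈ ℛ(μ,d) the vector of subordinate groups' weights of H weakly majorizes that of T: f(H) ⪰^w f(T). -/

import Mathlib

open scoped Classical
noncomputable section

/-- A directed tree on a finite vertex set `V`: each vertex has an outbound arc to its
`parent`, the `root` is a fixed point of `parent` (i.e. has no genuine outbound arc), and
every vertex reaches the root by iterating `parent`. -/
structure DirTree (V : Type) [Fintype V] [DecidableEq V] where
  root : V
  parent : V → V
  parent_root : parent root = root
  reaches : ∀ v, ∃ n, parent^[n] v = root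

variable {V : Type} [Fintype V] [DecidableEq V]

namespace DirTree

/-- `u` belongs to the subordinate group of `v`: there is a directed path from `u` to `v`. -/
def Desc (T : DirTree V) (u v : V) : Prop := ∃ n, T.parent^[n] u = v

/-- The set of vertices with an arc to `v`. -/
def children (T : DirTree V) (v : V) : Finset V :=
  Finset.univ.filter fun u => T.parent u = v ∧ u ≠ v

/-- Weight `f_T(v)` of the subordinate group of `v`. -/
def f (T : DirTree V) (μ : V → ℝ) (v : V) : ℝ :=
  ∑ u ∈ Finset.univ.filter (fun u => T.Desc u v), μ u

/-- Degree of `v` in the underlying undirected tree. -/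
def deg (T : DirTree V) (v : V) : ℕ :=
  (T.children v).card + (if v = T.root then 0 else 1)

/-- The underlying undirected tree. -/
def toGraph (T : DirTree V) : SimpleGraph V :=
  SimpleGraph.fromRel fun u v => T.parent u = v ∧ u ≠ v

/-- The vector (as a multiset, i.e. up to ascending rearrangement) of subordinate
groups' weights of internal non-root vertices. -/
def fvec (T : DirTree V) (μ : V → ℝ) : Multiset ℝ :=
  (Finset.univ.filter fun m => 1 < T.deg m ∧ m ≠ T.root).val.map (T.f μ)

end DirTree

/-- Degree of a vertex in a simple graph. -/
def gdeg (G : SimpleGraph V) (v : V) : ℕ :=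
  (Finset.univ.filter fun u => G.Adj v u).card

/-- `⟨μ, d⟩` is a generating tuple: nonnegative weights, degrees at least 1 summing to
`2(|V|-1)`, at least two pendent and at least one internal vertex. -/
structure IsGenTuple (μ : V → ℝ) (d : V → ℕ) : Prop where
  nonneg : ∀ v, 0 ≤ μ v
  deg_pos : ∀ v, 1 ≤ d v
  sum_deg : ∑ v, d v = 2 * (Fintype.card V - 1)
  two_le_pendent : 2 ≤ (Finset.univ.filter fun v => d v = 1).card
  one_le_internal : 1 ≤ (Finset.univ.filter fun v => 1 < d v).card

/-- Weights are degree-monotone in `⟨μ, d⟩`. -/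
def DegMonotone (μ : V → ℝ) (d : V → ℕ) : Prop :=
  (∀ m m', 1 < d m → 1 < d m' → d m < d m' → μ m ≤ μ m') ∧
  ∀ v, d v = 1 → 0 < μ v

/-- `T ∈ ℛ(μ,d)`: directed tree with internal root whose (undirected) degrees match `d`. -/
def memR (T : DirTree V) (d : V → ℕ) : Prop :=
  1 < d T.root ∧ ∀ v, T.deg v = d v

/-- `G ∈ 𝒯(μ,d)`: `G` is a tree whose degrees match `d`. -/
def memT (G : SimpleGraph V) (d : V → ℕ) : Prop :=
  G.IsTree ∧ ∀ v, gdeg G v = d v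

/-- Vertex-weighted Wiener index. -/
def VWWI (μ : V → ℝ) (G : SimpleGraph V) : ℝ :=
  (1 / 2) * ∑ u, ∑ v, μ u * μ v * (G.dist u v : ℝ)

/-- `S = (m, L)` is a minimal star for the state `(U, μ, d)`: the center `m` is an
internal vertex of `U` of least degree among internal vertices of least weight, and the
`d m - 1` leaves `L` are pendent vertices of `U` of least weights. -/
def IsMinimalStar (U : Finset V) (μ : V → ℝ) (d : V → ℕ) (m : V) (L : Finset V) : Prop :=
  m ∈ U ∧ 1 < d m ∧ L ⊆ U ∧ m ∉ L ∧ L.card = d m - 1 ∧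
  (∀ v ∈ L, d v = 1) ∧
  (∀ m' ∈ U, 1 < d m' → μ m ≤ μ m') ∧
  (∀ m' ∈ U, 1 < d m' → μ m' = μ m → d m ≤ d m') ∧
  ∀ u ∈ L, ∀ w ∈ U, d w = 1 → w ∉ L → μ u ≤ μ w

/-- Centers used before step `i` (0-indexed). -/
def usedCenters {q : ℕ} (c : Fin q → V) (i : ℕ) : Finset V :=
  (Finset.univ.filter fun j : Fin q => (j : ℕ) < i).image c

/-- Vertex set `V_{i+1}` of the state of the Huffman algorithm before (0-indexed) step `i`,
for the candidate Huffman tree `T` with star centers `c`. -/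
def stateV (T : DirTree V) {q : ℕ} (c : Fin q → V) (i : ℕ) : Finset V :=
  Finset.univ \ (Finset.univ.filter fun j : Fin q => (j : ℕ) < i).biUnion fun j => T.children (c j)

/-- Weight function `μ^{i+1}` of the state before (0-indexed) step `i`. -/
def stateMu (T : DirTree V) (μ : V → ℝ) {q : ℕ} (c : Fin q → V) (i : ℕ) : V → ℝ :=
  fun v => if v ∈ usedCenters c i then T.f μ v else μ v

/-- Degree function `d^{i+1}` of the state before (0-indexed) step `i`. -/
def stateD (d : V → ℕ) {q : ℕ} (c : Fin q → V) (i : ℕ) : V → ℕ :=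
  fun v => if v ∈ usedCenters c i then 1 else d v

/-- `T` is a directed Huffman tree for `⟨μ, d⟩` whose star sequence has centers
`c 0, …, c (q-1)` (so `S_i` has leaf set `children (c i)`): the centers enumerate the
internal vertices, the root is the last center, and at each of the first `q - 1` steps
the corresponding star is a minimal star of the current state. -/
def IsHuffmanSeq (μ : V → ℝ) (d : V → ℕ) (T : DirTree V) {q : ℕ} (c : Fin q → V) : Prop :=
  (∀ v, T.deg v = d v) ∧
  Function.Injective c ∧
  (∀ v, 1 < d v ↔ ∃ j, c j = v) ∧
  (∀ hq : 0 < q, T.root = c ⟨q - 1, Nat.sub_lt hq Nat.one_pos⟩) ∧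
  ∀ i : Fin q, (i : ℕ) < q - 1 →
    IsMinimalStar (stateV T c (i : ℕ)) (stateMu T μ c (i : ℕ)) (stateD d c (i : ℕ))
      (c i) (T.children (c i))

/-- `T ∈ ℛℋ(μ,d)`: `T` is a directed Huffman tree for `⟨μ, d⟩`. -/
def IsHuffmanDir (μ : V → ℝ) (d : V → ℕ) (T : DirTree V) : Prop :=
  ∃ (q : ℕ) (c : Fin q → V), IsHuffmanSeq μ d T c

/-- Sum of the `k` smallest components of a multiset of reals. -/
def ascSum (s : Multiset ℝ) (k : ℕ) : ℝ := ((s.sort (· ≤ ·)).take k).sum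

/-- `x` weakly majorizes `y` (`y ⪯^w x`). -/
def WMaj (x y : Multiset ℝ) : Prop :=
  Multiset.card x = Multiset.card y ∧ ∀ k, ascSum x k ≤ ascSum y k

/-- `x` strictly weakly majorizes `y` (`y ≺^w x`). -/
def SWMaj (x y : Multiset ℝ) : Prop := WMaj x y ∧ x ≠ y

/-- Levels `lev` assigned to the pendent vertices `P` and the chosen internal vertices `K` leave
enough vertices strictly below each level to serve as children of the members of `K` on or below
that level. -/
def TailFeasible {α : Type*} [DecidableEq α] (P K : Finset α) (c lev : α → ℕ) : Prop :=
  ∀ l, ∑ v ∈ K, (if l ≤ lev v then c v else 0) ≤ ∑ v ∈ P ∪ K, (if l < lev v then 1 else 0)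

/-- The total weight of the groups of `K`, expressed through levels. -/
def levelCost {α : Type*} (P K : Finset α) (μ : α → ℝ) (lev : α → ℕ) : ℝ :=
  ∑ v ∈ P, μ v * lev v + ∑ v ∈ K, μ v * (lev v + 1)

lemma sum_swap_levels {α M : Type*} [DecidableEq α] [AddCommMonoid M]
    {S : Finset α} {a b : α} (ha : a ∈ S)
    (hb : b ∈ S) (hab : a ≠ b) (lev : α → ℕ) (F : α → ℕ → M) :
    ∑ v ∈ S, F v (lev (Equiv.swap a b v)) =
        F a (lev b) + (F b (lev a) + ∑ v ∈ (S.erase a).erase b, F v (lev v)) := by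
  have hb' : b ∈ S.erase a := Finset.mem_erase.2 ⟨hab.symm, hb⟩
  rw [← Finset.add_sum_erase _ _ ha, ← Finset.add_sum_erase _ _ hb', Equiv.swap_apply_left,
    Equiv.swap_apply_right]
  congr 2
  refine Finset.sum_congr rfl fun v hv => ?_
  simp only [Finset.mem_erase] at hv
  rw [Equiv.swap_apply_of_ne_of_ne hv.2.1 hv.1]

lemma sum_split_two {α M : Type*} [DecidableEq α] [AddCommMonoid M]
    {S : Finset α} {a b : α} (ha : a ∈ S)
    (hb : b ∈ S) (hab : a ≠ b) (F : α → M) :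
    ∑ v ∈ S, F v = F a + (F b + ∑ v ∈ (S.erase a).erase b, F v) := by
  have hb' : b ∈ S.erase a := Finset.mem_erase.2 ⟨hab.symm, hb⟩
  rw [← Finset.add_sum_erase _ _ ha, ← Finset.add_sum_erase _ _ hb']

lemma sum_swap_count {α : Type*} [DecidableEq α] {S : Finset α} {a b : α} (ha : a ∈ S)
    (hb : b ∈ S) (lev : α → ℕ) (G : ℕ → ℕ) :
    ∑ v ∈ S, G (lev (Equiv.swap a b v)) = ∑ v ∈ S, G (lev v) := by
  rcases eq_or_ne a b with rfl | hab
  · simp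
  · rw [sum_swap_levels ha hb hab lev fun _ n => G n, sum_split_two ha hb hab]
    abel

/-- The lightest internal vertex can be moved to the deepest level of the chosen set. -/
lemma exists_center_deepest {α : Type*} [DecidableEq α]
    {P I K : Finset α} {μ : α → ℝ} {c lev : α → ℕ} {m : α}
    (hPI : Disjoint P I) (hm : m ∈ I) (hmin : ∀ m' ∈ I, μ m ≤ μ m' ∧ c m ≤ c m') (hK : K ⊆ I)
    (hne : K.Nonempty) (hfeas : TailFeasible P K c lev) :
    ∃ K' lev', K' ⊆ I ∧ K'.card = K.card ∧ m ∈ K' ∧ (∀ v ∈ K', lev' v ≤ lev' m) ∧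
      TailFeasible P K' c lev' ∧ levelCost P K' μ lev' ≤ levelCost P K μ lev := by
  obtain ⟨b, hb, hbmax⟩ := Finset.exists_max_image K lev hne
  have hmP : m ∉ P := fun h => Finset.disjoint_left.1 hPI h hm
  have hbP : b ∉ P := fun h => Finset.disjoint_left.1 hPI h (hK hb)
  obtain ⟨hμ, hc⟩ := hmin b (hK hb)
  by_cases hmK : m ∈ K
  · rcases eq_or_ne m b with rfl | hne
    · exact ⟨K, lev, hK, rfl, hb, hbmax, hfeas, le_rfl⟩
    have hle := hbmax m hmK
    refine ⟨K, fun v => lev (Equiv.swap m b v), hK, rfl, hmK, fun v hv => ?_, fun l => ?_, ?_⟩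
    · simp only [Equiv.swap_apply_left]
      by_cases h1 : v = m
      · subst h1; simp
      by_cases h2 : v = b
      · subst h2; simpa using hle
      rw [Equiv.swap_apply_of_ne_of_ne h1 h2]
      exact hbmax v hv
    · rw [sum_swap_count (Finset.mem_union_right _ hmK) (Finset.mem_union_right _ hb) lev
        (fun n => if l < n then 1 else 0)]
      refine le_trans ?_ (hfeas l)
      rw [sum_swap_levels hmK hb hne lev (fun v n => if l ≤ n then c v else 0),
        sum_split_two hmK hb hne]
      split_ifs <;> omega
    · unfold levelCost
      rw [sum_swap_levels hmK hb hne lev (fun v n => μ v * ((n : ℝ) + 1)),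
        sum_split_two hmK hb hne (fun v => μ v * ((lev v : ℝ) + 1))]
      have hP : ∑ v ∈ P, μ v * (lev (Equiv.swap m b v) : ℝ) = ∑ v ∈ P, μ v * lev v :=
        Finset.sum_congr rfl fun v hv => by
          rw [Equiv.swap_apply_of_ne_of_ne (by rintro rfl; exact hmP hv)
            (by rintro rfl; exact hbP hv)]
      have : (lev m : ℝ) ≤ lev b := by exact_mod_cast hle
      rw [hP]
      nlinarith [mul_nonneg (sub_nonneg.2 hμ) (sub_nonneg.2 this)]
  · have hmK' : m ∉ K.erase b := fun h => hmK (Finset.mem_of_mem_erase h)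
    have hlev : ∀ v, v ≠ m → Function.update lev m (lev b) v = lev v := fun v hv =>
      Function.update_of_ne hv _ _
    have hKm : ∀ v ∈ K.erase b, v ≠ m := by rintro v hv rfl; exact hmK' hv
    refine ⟨insert m (K.erase b), Function.update lev m (lev b), ?_, ?_, ?_, ?_, fun l => ?_, ?_⟩
    · exact Finset.insert_subset hm ((Finset.erase_subset _ _).trans hK)
    · rw [Finset.card_insert_of_notMem hmK', Finset.card_erase_add_one hb]
    · exact Finset.mem_insert_self _ _
    · intro v hv
      rw [Function.update_self]
      rcases Finset.mem_insert.1 hv with rfl | hv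
      · simp
      · rw [hlev v (hKm v hv)]
        exact hbmax v (Finset.mem_of_mem_erase hv)
    · have h := hfeas l
      have hd : Disjoint P K := hPI.mono_right hK
      have hd' : Disjoint P (insert m (K.erase b)) :=
        hPI.mono_right (Finset.insert_subset hm ((Finset.erase_subset _ _).trans hK))
      rw [Finset.sum_union hd, ← Finset.add_sum_erase K _ hb,
        ← Finset.add_sum_erase K _ hb] at h
      rw [Finset.sum_union hd', Finset.sum_insert hmK', Finset.sum_insert hmK',
        Function.update_self]
      rw [Finset.sum_congr rfl fun v hv => by rw [hlev v (hKm v hv)],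
        Finset.sum_congr (s₁ := P) rfl fun v hv => by
          rw [hlev v (by rintro rfl; exact hmP hv)],
        Finset.sum_congr (s₁ := K.erase b) (f := fun v => if l < _ then 1 else 0)
          rfl fun v hv => by rw [hlev v (hKm v hv)]]
      split_ifs at h ⊢ <;> omega
    · unfold levelCost
      rw [Finset.sum_insert hmK', ← Finset.add_sum_erase K _ hb, Function.update_self,
        Finset.sum_congr (s₁ := P) rfl fun v hv => by
          rw [hlev v (by rintro rfl; exact hmP hv)],
        Finset.sum_congr (s₁ := K.erase b) rfl fun v hv => by rw [hlev v (hKm v hv)]]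
      have : (0 : ℝ) ≤ (lev b : ℝ) + 1 := by positivity
      nlinarith [mul_nonneg (sub_nonneg.2 hμ) this]

/-- The lightest pendent vertices can be moved below a level that is sufficiently populated. -/
lemma exists_leaves_deepest {α : Type*} [DecidableEq α]
    {P K L : Finset α} {μ : α → ℝ} {c : α → ℕ} {D : ℕ}
    (hPK : Disjoint P K) (hL : L ⊆ P) (hLmin : ∀ u ∈ L, ∀ w ∈ P, w ∉ L → μ u ≤ μ w) (n : ℕ) :
    ∀ lev : α → ℕ, (L.filter fun v => lev v ≤ D).card = n →
      L.card ≤ (P.filter fun v => D < lev v).card → TailFeasible P K c lev →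
    ∃ lev' : α → ℕ, (∀ v ∈ K, lev' v = lev v) ∧ (∀ v ∈ L, D < lev' v) ∧
      TailFeasible P K c lev' ∧ levelCost P K μ lev' ≤ levelCost P K μ lev := by
  induction n with
  | zero =>
    intro lev hn _ hfeas
    refine ⟨lev, fun _ _ => rfl, fun v hv => ?_, hfeas, le_rfl⟩
    by_contra h
    exact Finset.notMem_empty v
      (Finset.card_eq_zero.1 hn ▸ Finset.mem_filter.2 ⟨hv, not_lt.1 h⟩)
  | succ n ih =>
    intro lev hn hcard hfeas
    obtain ⟨u, hu⟩ : (L.filter fun v => lev v ≤ D).Nonempty :=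
      Finset.card_pos.1 (by omega)
    obtain ⟨huL, huD⟩ := Finset.mem_filter.1 hu
    obtain ⟨w, hwP, hwL, hwD⟩ : ∃ w ∈ P, w ∉ L ∧ D < lev w := by
      by_contra! hcon
      have hsub : (P.filter fun v => D < lev v) ⊆ L.erase u := by
        intro v hv
        obtain ⟨hvP, hvD⟩ := Finset.mem_filter.1 hv
        refine Finset.mem_erase.2 ⟨by rintro rfl; omega, ?_⟩
        by_contra hvL
        exact absurd (hcon v hvP hvL) (by omega)
      have h1 := Finset.card_le_card hsub
      have h2 := Finset.card_erase_add_one huL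
      omega
    have huP := hL huL
    have huw : u ≠ w := by rintro rfl; exact hwL huL
    have hnotK : ∀ v ∈ P, v ∉ K := fun v hv h => Finset.disjoint_left.1 hPK hv h
    have hKeq : ∀ v ∈ K, lev (Equiv.swap u w v) = lev v := fun v hv => by
      rw [Equiv.swap_apply_of_ne_of_ne (by rintro rfl; exact hnotK _ huP hv)
        (by rintro rfl; exact hnotK _ hwP hv)]
    have hLeq : ∀ v ∈ L, v ≠ u → lev (Equiv.swap u w v) = lev v := fun v hv hvu => by
      rw [Equiv.swap_apply_of_ne_of_ne hvu (by rintro rfl; exact hwL hv)]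
    have hn' : (L.filter fun v => lev (Equiv.swap u w v) ≤ D).card = n := by
      have : (L.filter fun v => lev (Equiv.swap u w v) ≤ D) =
          (L.filter fun v => lev v ≤ D).erase u := by
        ext v
        simp only [Finset.mem_filter, Finset.mem_erase]
        by_cases hvu : v = u
        · subst hvu
          simp [hwD]
        · constructor
          · rintro ⟨a, b⟩
            exact ⟨hvu, a, hLeq v a hvu ▸ b⟩
          · rintro ⟨-, a, b⟩
            exact ⟨a, (hLeq v a hvu).symm ▸ b⟩
      rw [this, Finset.card_erase_of_mem hu, hn, Nat.add_sub_cancel]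
    have hcard' : L.card ≤ (P.filter fun v => D < lev (Equiv.swap u w v)).card := by
      rw [Finset.card_filter] at hcard ⊢
      rwa [sum_swap_count huP hwP lev (fun n => if D < n then 1 else 0)]
    have hfeas' : TailFeasible P K c fun v => lev (Equiv.swap u w v) := by
      intro l
      beta_reduce
      rw [sum_swap_count (Finset.mem_union_left _ huP) (Finset.mem_union_left _ hwP) lev
        (fun n => if l < n then 1 else 0),
        Finset.sum_congr rfl fun v hv => by rw [hKeq v hv]]
      exact hfeas l
    obtain ⟨lev', h1, h2, h3, h4⟩ := ih _ hn' hcard' hfeas'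
    refine ⟨lev', fun v hv => (h1 v hv).trans (hKeq v hv), h2, h3, h4.trans ?_⟩
    unfold levelCost
    beta_reduce
    rw [sum_swap_levels huP hwP huw lev (fun v n => μ v * (n : ℝ)),
      sum_split_two huP hwP huw (fun v => μ v * (lev v : ℝ)),
      Finset.sum_congr (s₁ := K) rfl fun v hv => by rw [hKeq v hv]]
    have hle : (lev u : ℝ) ≤ lev w := by exact_mod_cast (huD.trans hwD.le)
    nlinarith [mul_nonneg (sub_nonneg.2 (hLmin u huL w hwP hwL)) (sub_nonneg.2 hle)]

/-- Contracting a minimal star: the chosen set can be rearranged so that it uses the star, and the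
star then accounts for its total weight in the cost. -/
lemma exists_contract_star {α : Type*} [DecidableEq α]
    {P I K L : Finset α} {μ ν : α → ℝ} {c lev : α → ℕ} {m : α}
    (hPI : Disjoint P I) (hm : m ∈ I) (hmin : ∀ m' ∈ I, μ m ≤ μ m' ∧ c m ≤ c m')
    (hL : L ⊆ P) (hLcard : L.card = c m) (hLmin : ∀ u ∈ L, ∀ w ∈ P, w ∉ L → μ u ≤ μ w)
    (hμ : ∀ v ∈ L, 0 ≤ μ v) (hν : ν m = μ m + ∑ v ∈ L, μ v) (hνμ : ∀ v ≠ m, ν v = μ v)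
    (hK : K ⊆ I) (hne : K.Nonempty) (hfeas : TailFeasible P K c lev) :
    ∃ K' lev', K' ⊆ I.erase m ∧ K'.card + 1 = K.card ∧
      TailFeasible (insert m (P \ L)) K' c lev' ∧
      ν m + levelCost (insert m (P \ L)) K' ν lev' ≤ levelCost P K μ lev := by
  obtain ⟨K₁, lev₁, hK₁, hcard₁, hmK₁, hmax₁, hfeas₁, hcost₁⟩ :=
    exists_center_deepest hPI hm hmin hK hne hfeas
  have hPK : Disjoint P K₁ := hPI.mono_right hK₁
  have hLP : L.card ≤ (P.filter fun v => lev₁ m < lev₁ v).card := by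
    have h := hfeas₁ (lev₁ m)
    rw [Finset.sum_union hPK, ← Finset.card_filter,
      Finset.sum_congr (s₁ := K₁) (f := fun v => if _ < _ then 1 else 0) rfl fun v hv =>
        if_neg (not_lt.2 (hmax₁ v hv)), Finset.sum_const_zero,
      ← Finset.add_sum_erase _ _ hmK₁, if_pos le_rfl] at h
    omega
  obtain ⟨lev₂, hlev₂, hLdeep, hfeas₂, hcost₂⟩ :=
    exists_leaves_deepest hPK hL hLmin _ lev₁ rfl hLP hfeas₁
  have hmP : m ∉ P := fun h => Finset.disjoint_left.1 hPI h hm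
  have hmPL : m ∉ P \ L := fun h => hmP (Finset.mem_sdiff.1 h).1
  have hdeep : ∀ v ∈ L, lev₂ m < lev₂ v := fun v hv => by
    rw [hlev₂ m hmK₁]; exact hLdeep v hv
  refine ⟨K₁.erase m, lev₂, Finset.erase_subset_erase _ hK₁, ?_, fun l => ?_, ?_⟩
  · rw [Finset.card_erase_add_one hmK₁, hcard₁]
  · by_cases hl : l ≤ lev₂ m
    · have h := hfeas₂ l
      have hunion : insert m (P \ L) ∪ K₁.erase m = (P ∪ K₁) \ L := by
        ext v
        have : v ∈ L → v ∉ K₁ := fun h => Finset.disjoint_left.1 hPK (hL h)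
        have : m ∉ L := fun h => hmP (hL h)
        simp only [Finset.mem_union, Finset.mem_insert, Finset.mem_sdiff, Finset.mem_erase]
        grind
      have hsplit := Finset.sum_sdiff (f := fun v => if l < lev₂ v then 1 else 0)
        (hL.trans (Finset.subset_union_left (s₂ := K₁)))
      have hLsum : ∑ v ∈ L, (if l < lev₂ v then 1 else 0) = c m := by
        rw [Finset.sum_congr rfl fun v hv => if_pos (hl.trans_lt (hdeep v hv))]
        simp [hLcard]
      rw [← Finset.add_sum_erase _ _ hmK₁, if_pos hl] at h
      rw [hunion]
      omega
    · rw [Finset.sum_eq_zero]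
      · exact Nat.zero_le _
      · intro v hv
        have hvK := Finset.mem_of_mem_erase hv
        have := hmax₁ v hvK
        rw [← hlev₂ v hvK, ← hlev₂ m hmK₁] at this
        exact if_neg (by omega)
  · refine le_trans ?_ (hcost₂.trans hcost₁)
    unfold levelCost
    rw [Finset.sum_insert hmPL, ← Finset.add_sum_erase _ _ hmK₁, ← Finset.sum_sdiff hL,
      Finset.sum_congr (s₁ := P \ L) (f := fun v => ν v * _) rfl fun v hv => by
        rw [hνμ v (by rintro rfl; exact hmPL hv)],
      Finset.sum_congr (s₁ := K₁.erase m) (f := fun v => ν v * _) rfl fun v hv => by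
        rw [hνμ v (Finset.ne_of_mem_erase hv)]]
    have hLsum : ∑ v ∈ L, μ v * ((lev₂ m : ℝ) + 1) ≤ ∑ v ∈ L, μ v * (lev₂ v : ℝ) :=
      Finset.sum_le_sum fun v hv => mul_le_mul_of_nonneg_left
        (by exact_mod_cast hdeep v hv) (hμ v hv)
    rw [← Finset.sum_mul] at hLsum
    rw [hν]
    linarith

namespace DirTree

lemma mem_children {T : DirTree V} {u v : V} : u ∈ T.children v ↔ T.parent u = v ∧ u ≠ v := by
  simp [children]

lemma desc_refl (T : DirTree V) (v : V) : T.Desc v v := ⟨0, rfl⟩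

lemma Desc.trans {T : DirTree V} {u v w : V} (h₁ : T.Desc u v) (h₂ : T.Desc v w) :
    T.Desc u w := by
  obtain ⟨a, rfl⟩ := h₁
  obtain ⟨b, rfl⟩ := h₂
  exact ⟨b + a, Function.iterate_add_apply _ _ _ _⟩

lemma desc_parent (T : DirTree V) (v : V) : T.Desc v (T.parent v) := ⟨1, rfl⟩

lemma desc_iff {T : DirTree V} {u v : V} : T.Desc u v ↔ u = v ∨ T.Desc (T.parent u) v := by
  constructor
  · rintro ⟨_ | n, h⟩
    · exact Or.inl h
    · exact Or.inr ⟨n, h⟩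
  · rintro (rfl | h)
    · exact T.desc_refl _
    · exact (T.desc_parent u).trans h

lemma eq_root_of_iterate_eq {T : DirTree V} {v : V} {n : ℕ} (hn : 0 < n)
    (h : T.parent^[n] v = v) : v = T.root := by
  obtain ⟨N, hN⟩ := T.reaches v
  have hper : T.parent^[n * N] v = v := by
    rw [Function.iterate_mul]
    exact Function.iterate_fixed h N
  obtain ⟨k, hk⟩ := Nat.exists_eq_add_of_le' (Nat.le_mul_of_pos_left N hn)
  rw [hk, Function.iterate_add_apply, hN, Function.iterate_fixed T.parent_root] at hper
  exact hper.symm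

lemma Desc.antisymm {T : DirTree V} {u v : V} (h₁ : T.Desc u v) (h₂ : T.Desc v u) : u = v := by
  obtain ⟨a, rfl⟩ := h₁
  obtain ⟨b, hb⟩ := h₂
  rw [← Function.iterate_add_apply] at hb
  rcases Nat.eq_zero_or_pos (b + a) with h | h
  · obtain ⟨-, rfl⟩ := Nat.add_eq_zero_iff.1 h
    rfl
  · rw [eq_root_of_iterate_eq h hb, Function.iterate_fixed T.parent_root]

lemma Desc.total {T : DirTree V} {u v w : V} (h₁ : T.Desc u v) (h₂ : T.Desc u w) :
    T.Desc v w ∨ T.Desc w v := by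
  obtain ⟨a, rfl⟩ := h₁
  obtain ⟨b, rfl⟩ := h₂
  rcases le_total a b with h | h
  · obtain ⟨k, rfl⟩ := Nat.exists_eq_add_of_le' h
    exact Or.inl ⟨k, (Function.iterate_add_apply _ _ _ _).symm⟩
  · obtain ⟨k, rfl⟩ := Nat.exists_eq_add_of_le' h
    exact Or.inr ⟨k, (Function.iterate_add_apply _ _ _ _).symm⟩

lemma not_desc_of_mem_children {T : DirTree V} {u v : V} (h : u ∈ T.children v) :
    ¬ T.Desc v u := by
  obtain ⟨rfl, hne⟩ := mem_children.1 h
  exact fun h => hne ((T.desc_parent u).antisymm h)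

lemma desc_of_mem_children {T : DirTree V} {u v : V} (h : u ∈ T.children v) : T.Desc u v := by
  obtain ⟨rfl, -⟩ := mem_children.1 h
  exact T.desc_parent u

lemma desc_child_iff {T : DirTree V} {u v w : V} (h : u ∈ T.children v) :
    T.Desc u w ↔ u = w ∨ T.Desc v w := by
  obtain ⟨rfl, -⟩ := mem_children.1 h
  exact desc_iff

lemma eq_of_desc_children {T : DirTree V} {m u v w : V} (hv : v ∈ T.children m)
    (hw : w ∈ T.children m) (h₁ : T.Desc u v) (h₂ : T.Desc u w) : v = w := by
  rcases h₁.total h₂ with h | h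
  · exact ((desc_child_iff hv).1 h).resolve_right (not_desc_of_mem_children hw)
  · exact (((desc_child_iff hw).1 h).resolve_right (not_desc_of_mem_children hv)).symm

lemma desc_iff_children {T : DirTree V} {u m : V} :
    T.Desc u m ↔ u = m ∨ ∃ v ∈ T.children m, T.Desc u v := by
  constructor
  · rintro ⟨n, h⟩
    induction n generalizing m with
    | zero => exact Or.inl h
    | succ n ih =>
      rw [Function.iterate_succ_apply'] at h
      by_cases heq : T.parent^[n] u = m
      · exact ih heq
      · exact Or.inr ⟨_, mem_children.2 ⟨h, heq⟩, n, rfl⟩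
  · rintro (rfl | ⟨v, hv, h⟩)
    · exact T.desc_refl _
    · exact h.trans (desc_of_mem_children hv)

lemma f_eq (T : DirTree V) (μ : V → ℝ) (m : V) :
    T.f μ m = μ m + ∑ v ∈ T.children m, T.f μ v := by
  have hset : (Finset.univ.filter fun u => T.Desc u m) =
      insert m ((T.children m).biUnion fun v => Finset.univ.filter fun u => T.Desc u v) := by
    ext u
    simp only [Finset.mem_filter, Finset.mem_univ, true_and, Finset.mem_insert,
      Finset.mem_biUnion]
    exact desc_iff_children
  unfold f
  rw [hset, Finset.sum_insert, Finset.sum_biUnion]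
  · intro v hv w hw hvw
    refine Finset.disjoint_left.2 fun u hu hu' => hvw ?_
    simp only [Finset.mem_filter, Finset.mem_univ, true_and] at hu hu'
    exact eq_of_desc_children hv hw hu hu'
  · simp only [Finset.mem_biUnion, Finset.mem_filter, Finset.mem_univ, true_and, not_exists,
      not_and]
    exact fun v hv => not_desc_of_mem_children hv

lemma f_nonneg (T : DirTree V) {μ : V → ℝ} (hμ : ∀ v, 0 ≤ μ v) (v : V) : 0 ≤ T.f μ v :=
  Finset.sum_nonneg fun _ _ => hμ _

lemma f_le_of_desc (T : DirTree V) {μ : V → ℝ} (hμ : ∀ v, 0 ≤ μ v) {u v : V}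
    (h : T.Desc u v) : T.f μ u ≤ T.f μ v := by
  refine Finset.sum_le_sum_of_subset_of_nonneg (fun w hw => ?_) fun _ _ _ => hμ _
  simp only [Finset.mem_filter, Finset.mem_univ, true_and] at hw ⊢
  exact hw.trans h

lemma card_desc_lt (T : DirTree V) {u v : V} (h : T.Desc u v) (hne : u ≠ v) :
    (Finset.univ.filter fun w => T.Desc w u).card <
      (Finset.univ.filter fun w => T.Desc w v).card := by
  refine Finset.card_lt_card ((Finset.ssubset_iff_of_subset fun w hw => ?_).2 ⟨v, ?_, ?_⟩)
  · simp only [Finset.mem_filter, Finset.mem_univ, true_and] at hw ⊢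
    exact hw.trans h
  · simpa using T.desc_refl v
  · simpa using fun h' => hne (h.antisymm h')

/-- The number of members of `K` strictly above `v`. -/
def level (T : DirTree V) (K : Finset V) (v : V) : ℕ :=
  (K.filter fun m => m ≠ v ∧ T.Desc v m).card

lemma level_of_mem_children {T : DirTree V} {K : Finset V} {m v : V} (hm : m ∈ K)
    (hv : v ∈ T.children m) : T.level K v = T.level K m + 1 := by
  have : (K.filter fun w => w ≠ v ∧ T.Desc v w) =
      insert m (K.filter fun w => w ≠ m ∧ T.Desc m w) := by
    ext w
    simp only [Finset.mem_filter, Finset.mem_insert]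
    have h1 := desc_child_iff (w := w) hv
    have h2 := not_desc_of_mem_children hv
    have h3 := T.desc_refl m
    by_cases hwm : w = m
    · subst hwm
      exact ⟨fun _ => Or.inl rfl, fun _ =>
        ⟨hm, (mem_children.1 hv).2.symm, desc_of_mem_children hv⟩⟩
    · by_cases hwv : w = v
      · subst hwv
        simp [hwm, h2]
      · simp [hwm, hwv, h1, Ne.symm hwv]
  unfold level
  rw [this, Finset.card_insert_of_notMem (by simp)]

lemma tailFeasible_level {T : DirTree V} {P K : Finset V} {c : V → ℕ}
    (hc : ∀ m ∈ K, (T.children m).card = c m) (hsub : ∀ m ∈ K, T.children m ⊆ P ∪ K) :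
    TailFeasible P K c (T.level K) := by
  intro l
  have hdisj : ((K.filter fun v => l ≤ T.level K v) : Set V).PairwiseDisjoint T.children := by
    intro a _ b _ hab
    refine Finset.disjoint_left.2 fun u hu hu' => hab ?_
    rw [← (mem_children.1 hu).1, ← (mem_children.1 hu').1]
  rw [← Finset.sum_filter, ← Finset.card_filter,
    Finset.sum_congr rfl fun m hm => (hc m (Finset.mem_filter.1 hm).1).symm,
    ← Finset.card_biUnion hdisj]
  refine Finset.card_le_card fun u hu => ?_
  obtain ⟨m, hm, hum⟩ := Finset.mem_biUnion.1 hu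
  obtain ⟨hmK, hml⟩ := Finset.mem_filter.1 hm
  refine Finset.mem_filter.2 ⟨hsub m hmK hum, ?_⟩
  rw [level_of_mem_children hmK hum]
  omega

lemma levelCost_level_le {T : DirTree V} {P K : Finset V} {μ : V → ℝ} (hμ : ∀ v, 0 ≤ μ v)
    (hPK : Disjoint P K) : levelCost P K μ (T.level K) ≤ ∑ m ∈ K, T.f μ m := by
  have hsum : ∑ m ∈ K, T.f μ m = ∑ u, μ u * ((K.filter fun m => T.Desc u m).card : ℝ) := by
    unfold f
    simp_rw [Finset.sum_filter]
    rw [Finset.sum_comm]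
    refine Finset.sum_congr rfl fun u _ => ?_
    rw [← Finset.sum_filter, Finset.sum_const, nsmul_eq_mul, mul_comm]
  have hP : ∀ u ∈ P, μ u * (T.level K u : ℝ) =
      μ u * ((K.filter fun m => T.Desc u m).card : ℝ) := fun u hu => by
    unfold level
    congr 3
    refine Finset.filter_congr fun m hm => ⟨And.right, fun h => ⟨?_, h⟩⟩
    rintro rfl
    exact Finset.disjoint_left.1 hPK hu hm
  have hK : ∀ u ∈ K, μ u * ((T.level K u : ℝ) + 1) =
      μ u * ((K.filter fun m => T.Desc u m).card : ℝ) := fun u hu => by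
    have : (K.filter fun m => T.Desc u m) =
        insert u (K.filter fun m => m ≠ u ∧ T.Desc u m) := by
      ext w
      simp only [Finset.mem_filter, Finset.mem_insert]
      have := T.desc_refl u
      by_cases hw : w = u
      · subst hw; simp [hu, this]
      · simp [hw]
    rw [this, Finset.card_insert_of_notMem (by simp)]
    push_cast
    rfl
  unfold levelCost
  rw [hsum, Finset.sum_congr rfl hP, Finset.sum_congr rfl hK, ← Finset.sum_union hPK]
  exact Finset.sum_le_sum_of_subset_of_nonneg (Finset.subset_univ _) fun u _ _ =>
    mul_nonneg (hμ u) (Nat.cast_nonneg _)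

/-- A set of vertices can be replaced by one of the same size, closed under children in `I`, without
increasing the total weight of its groups. -/
lemma exists_closed_of_card {T : DirTree V} {μ : V → ℝ} (hμ : ∀ v, 0 ≤ μ v) {I K : Finset V}
    (hK : K ⊆ I) :
    ∃ K' ⊆ I, K'.card = K.card ∧ (∀ m ∈ K', ∀ u ∈ T.children m, u ∈ I → u ∈ K') ∧
      ∑ m ∈ K', T.f μ m ≤ ∑ m ∈ K, T.f μ m := by
  let g : Finset V → ℝ ×ₗ ℕ := fun S =>
    toLex (∑ m ∈ S, T.f μ m, ∑ m ∈ S, (Finset.univ.filter fun w => T.Desc w m).card)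
  obtain ⟨K', hK', hmin⟩ := Finset.exists_min_image (I.powersetCard K.card) g
    ⟨K, Finset.mem_powersetCard.2 ⟨hK, rfl⟩⟩
  obtain ⟨hK'I, hcard⟩ := Finset.mem_powersetCard.1 hK'
  refine ⟨K', hK'I, hcard, fun m hm u hu huI => ?_, ?_⟩
  · by_contra huK
    have huK' : u ∉ K'.erase m := fun h => huK (Finset.mem_of_mem_erase h)
    have hd := desc_of_mem_children hu
    have hf := T.f_le_of_desc hμ hd
    have hlt := T.card_desc_lt hd (mem_children.1 hu).2
    refine absurd (hmin (insert u (K'.erase m)) (Finset.mem_powersetCard.2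
      ⟨Finset.insert_subset huI ((Finset.erase_subset _ _).trans hK'I), ?_⟩)) (not_le.2 ?_)
    · rw [Finset.card_insert_of_notMem huK', Finset.card_erase_add_one hm, hcard]
    · simp only [g]
      rw [Prod.Lex.toLex_lt_toLex, Finset.sum_insert huK', Finset.sum_insert huK',
        ← Finset.add_sum_erase K' _ hm, ← Finset.add_sum_erase K' _ hm]
      rcases hf.lt_or_eq with h | h
      · exact Or.inl (by simpa using h)
      · exact Or.inr ⟨by simpa using h, by simpa using hlt⟩
  · have := hmin K (Finset.mem_powersetCard.2 ⟨hK, rfl⟩)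
    simp only [g] at this
    rw [Prod.Lex.toLex_le_toLex] at this
    exact this.elim le_of_lt fun h => h.1.le

end DirTree

lemma sum_take_cons_le {a : ℝ} {l : List ℝ} (h : (a :: l).Pairwise (· ≤ ·)) {n : ℕ}
    (hn : n ≤ l.length) : ((a :: l).take n).sum ≤ (l.take n).sum := by
  induction l generalizing a n with
  | nil => simp [Nat.le_zero.1 hn]
  | cons b l ih =>
    cases n with
    | zero => simp
    | succ n =>
      have h1 := ih (List.pairwise_cons.1 h).2 (Nat.le_of_succ_le_succ hn)
      have h2 : a ≤ b := (List.pairwise_cons.1 h).1 b (by simp)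
      simp only [List.take_succ_cons, List.sum_cons] at h1 ⊢
      linarith

lemma sum_take_le_of_sublist {l l' : List ℝ} (hs : l'.Sublist l) (h : l.Pairwise (· ≤ ·)) :
    (l.take l'.length).sum ≤ l'.sum := by
  induction hs with
  | slnil => simp
  | cons a hs ih =>
    exact (sum_take_cons_le h hs.length_le).trans (ih (List.pairwise_cons.1 h).2)
  | cons_cons a hs ih =>
    simpa using ih (List.pairwise_cons.1 h).2

lemma ascSum_le_sum {s t : Multiset ℝ} (h : t ≤ s) : ascSum s (Multiset.card t) ≤ t.sum := by
  have h' : (t.toList : Multiset ℝ) ≤ (s.sort (· ≤ ·) : List ℝ) := by simpa using h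
  obtain ⟨l, hl, hsub⟩ := Multiset.coe_le.1 h'
  have hlen : l.length = Multiset.card t := by rw [hl.length_eq, Multiset.length_toList]
  have := sum_take_le_of_sublist hsub (Multiset.pairwise_sort s (· ≤ ·))
  rw [hlen, hl.sum_eq, Multiset.sum_toList] at this
  exact this

lemma ascSum_of_card_le {s : Multiset ℝ} {k : ℕ} (h : Multiset.card s ≤ k) :
    ascSum s k = ascSum s (Multiset.card s) := by
  unfold ascSum
  rw [List.take_of_length_le (by simpa using h), List.take_of_length_le (by simp)]

lemma exists_subset_ascSum {α : Type*} (S : Finset α) (g : α → ℝ) {k : ℕ} (hk : k ≤ S.card) :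
    ∃ K ⊆ S, K.card = k ∧ ∑ v ∈ K, g v = ascSum (S.val.map g) k := by
  set l := (S.val.map g).sort (· ≤ ·) with hl
  have hcoe : ((S.toList.map g : List ℝ) : Multiset ℝ) = l := by
    rw [hl, Multiset.sort_eq, ← Multiset.map_coe, Finset.coe_toList]
  have hlen : l.length = S.card := by simp [hl]
  obtain ⟨l₁, hperm, hsub⟩ :=
    (List.take_sublist k l).subperm.trans (Multiset.coe_eq_coe.1 hcoe).symm.subperm
  obtain ⟨l₂, hsub₂, rfl⟩ := List.sublist_map_iff.1 hsub
  have hnodup : l₂.Nodup := S.nodup_toList.sublist hsub₂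
  refine ⟨⟨l₂, hnodup⟩, fun v hv => Finset.mem_toList.1 (hsub₂.subset hv), ?_, ?_⟩
  · have := hperm.length_eq
    rw [List.length_map, List.length_take, hlen, min_eq_left hk] at this
    exact this
  · exact hperm.sum_eq

lemma mem_usedCenters {α : Type} [DecidableEq α] {q : ℕ} {c : Fin q → α} {i : ℕ} {v : α} :
    v ∈ usedCenters c i ↔ ∃ j : Fin q, (j : ℕ) < i ∧ c j = v := by
  simp [usedCenters]

lemma usedCenters_succ {α : Type} [DecidableEq α] {q : ℕ} (c : Fin q → α) (i : Fin q) :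
    usedCenters c ((i : ℕ) + 1) = insert (c i) (usedCenters c i) := by
  ext v
  simp only [Finset.mem_insert, mem_usedCenters]
  constructor
  · rintro ⟨j, hj, rfl⟩
    rcases Nat.lt_succ_iff_lt_or_eq.1 hj with h | h
    · exact Or.inr ⟨j, h, rfl⟩
    · exact Or.inl (congrArg c (Fin.ext h))
  · rintro (rfl | ⟨j, hj, rfl⟩)
    · exact ⟨i, Nat.lt_succ_self _, rfl⟩
    · exact ⟨j, hj.trans (Nat.lt_succ_self _), rfl⟩

lemma mem_stateV {T : DirTree V} {q : ℕ} {c : Fin q → V} {i : ℕ} {v : V} :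
    v ∈ stateV T c i ↔ ∀ j : Fin q, (j : ℕ) < i → v ∉ T.children (c j) := by
  simp [stateV]

lemma stateV_succ (T : DirTree V) {q : ℕ} (c : Fin q → V) (i : Fin q) :
    stateV T c ((i : ℕ) + 1) = stateV T c i \ T.children (c i) := by
  ext v
  simp only [Finset.mem_sdiff, mem_stateV]
  constructor
  · exact fun h => ⟨fun j hj => h j (hj.trans (Nat.lt_succ_self _)), h i (Nat.lt_succ_self _)⟩
  · rintro ⟨h1, h2⟩ j hj
    rcases Nat.lt_succ_iff_lt_or_eq.1 hj with h | h
    · exact h1 j h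
    · exact (Fin.ext h : j = i) ▸ h2

/-- Pendent vertices of the state of the Huffman algorithm before step `i`. -/
def statePendent (T : DirTree V) (d : V → ℕ) {q : ℕ} (c : Fin q → V) (i : ℕ) : Finset V :=
  (stateV T c i).filter fun v => stateD d c i v = 1

/-- Internal vertices of the state of the Huffman algorithm before step `i`. -/
def stateInternal (T : DirTree V) (d : V → ℕ) {q : ℕ} (c : Fin q → V) (i : ℕ) : Finset V :=
  (stateV T c i).filter fun v => 1 < stateD d c i v

lemma stateD_succ {α : Type} [DecidableEq α] (d : α → ℕ) {q : ℕ} (c : Fin q → α) (i : Fin q)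
    (v : α) :
    stateD d c ((i : ℕ) + 1) v = if v = c i then 1 else stateD d c i v := by
  unfold stateD
  rw [usedCenters_succ]
  by_cases h : v = c i <;> simp [h]

lemma stateMu_succ (T : DirTree V) (μ : V → ℝ) {q : ℕ} (c : Fin q → V) (i : Fin q) (v : V) :
    stateMu T μ c ((i : ℕ) + 1) v = if v = c i then T.f μ v else stateMu T μ c i v := by
  unfold stateMu
  rw [usedCenters_succ]
  by_cases h : v = c i <;> simp [h]

lemma stateMu_nonneg (T : DirTree V) {μ : V → ℝ} (hμ : ∀ v, 0 ≤ μ v) {q : ℕ} (c : Fin q → V)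
    (i : ℕ) (v : V) : 0 ≤ stateMu T μ c i v := by
  unfold stateMu
  split_ifs
  · exact T.f_nonneg hμ v
  · exact hμ v

lemma state_eq_of_one_lt {T : DirTree V} {μ : V → ℝ} {d : V → ℕ} {q : ℕ} {c : Fin q → V} {i : ℕ}
    {v : V} (h : 1 < stateD d c i v) :
    v ∉ usedCenters c i ∧ stateD d c i v = d v ∧ stateMu T μ c i v = μ v := by
  have hv : v ∉ usedCenters c i := fun hv => by simp [stateD, hv] at h
  exact ⟨hv, if_neg hv, if_neg hv⟩

lemma stateMu_eq_f {T : DirTree V} {μ : V → ℝ} {d : V → ℕ} (hdeg : ∀ v, T.deg v = d v) {q : ℕ}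
    {c : Fin q → V} {i : ℕ} {v : V} (hroot : v ≠ T.root) (h : stateD d c i v = 1) :
    stateMu T μ c i v = T.f μ v := by
  by_cases hv : v ∈ usedCenters c i
  · exact if_pos hv
  · have hd : d v = 1 := by simpa [stateD, hv] using h
    have hch : T.children v = ∅ := by
      have := hdeg v
      rw [hd, DirTree.deg, if_neg hroot] at this
      exact Finset.card_eq_zero.1 (by omega)
    rw [T.f_eq, hch, Finset.sum_empty, add_zero]
    exact if_neg hv

lemma statePendent_succ {μ : V → ℝ} {d : V → ℕ} {T : DirTree V} {q : ℕ} {c : Fin q → V}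
    {i : Fin q} (h : IsMinimalStar (stateV T c i) (stateMu T μ c i) (stateD d c i)
      (c i) (T.children (c i))) :
    statePendent T d c ((i : ℕ) + 1) =
      insert (c i) (statePendent T d c i \ T.children (c i)) := by
  ext v
  simp only [statePendent, stateV_succ, stateD_succ, Finset.mem_filter, Finset.mem_insert,
    Finset.mem_sdiff]
  by_cases hv : v = c i
  · subst hv
    simp [h.1, h.2.2.2.1]
  · simp only [hv, if_false, false_or]
    tauto

lemma stateInternal_succ {μ : V → ℝ} {d : V → ℕ} {T : DirTree V} {q : ℕ} {c : Fin q → V}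
    {i : Fin q} (h : IsMinimalStar (stateV T c i) (stateMu T μ c i) (stateD d c i)
      (c i) (T.children (c i))) :
    stateInternal T d c ((i : ℕ) + 1) = (stateInternal T d c i).erase (c i) := by
  ext v
  simp only [stateInternal, stateV_succ, stateD_succ, Finset.mem_filter, Finset.mem_erase,
    Finset.mem_sdiff]
  by_cases hv : v = c i
  · simp [hv]
  · have := h.2.2.2.2.2.1 v
    simp only [hv, if_false, ne_eq, not_false_eq_true, true_and]
    constructor
    · tauto
    · rintro ⟨h1, h2⟩
      exact ⟨⟨h1, fun h3 => by have := this h3; omega⟩, h2⟩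

lemma disjoint_state (T : DirTree V) (d : V → ℕ) {q : ℕ} (c : Fin q → V) (i : ℕ) :
    Disjoint (statePendent T d c i) (stateInternal T d c i) :=
  Finset.disjoint_filter.2 fun _ _ h => by omega

lemma minimalStar_le {μ : V → ℝ} {d : V → ℕ} (hmono : DegMonotone μ d) {T : DirTree V} {q : ℕ}
    {c : Fin q → V} {i : ℕ} {m : V} {L : Finset V}
    (h : IsMinimalStar (stateV T c i) (stateMu T μ c i) (stateD d c i) m L) :
    ∀ m' ∈ stateInternal T d c i,
      stateMu T μ c i m ≤ stateMu T μ c i m' ∧ d m - 1 ≤ d m' - 1 := by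
  intro m' hm'
  obtain ⟨hV, hD⟩ := Finset.mem_filter.1 hm'
  obtain ⟨-, hm, -, -, -, -, hw, hdm, -⟩ := h
  have hle := hw m' hV hD
  refine ⟨hle, Nat.sub_le_sub_right (not_lt.1 fun hlt => ?_) 1⟩
  have hdeg := hdm m' hV hD
  obtain ⟨-, h1, h2⟩ := state_eq_of_one_lt (T := T) (μ := μ) hm
  obtain ⟨-, h3, h4⟩ := state_eq_of_one_lt (T := T) (μ := μ) hD
  have hle' := hmono.1 m' m (h3 ▸ hD) (h1 ▸ hm) hlt
  rw [h2, h4] at hle hdeg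
  have := hdeg (le_antisymm hle' hle)
  omega

/-- Any `n` groups whose levels fit the state before step `i` cost at least as much as the groups
built by the next `n` steps of the Huffman algorithm. -/
lemma huffman_partial_sum_le {μ : V → ℝ} {d : V → ℕ} (hμ : ∀ v, 0 ≤ μ v)
    (hmono : DegMonotone μ d) {H : DirTree V} {q : ℕ} {c : Fin q → V}
    (hH : IsHuffmanSeq μ d H c) (n : ℕ) :
    ∀ i, i + n ≤ q - 1 → ∀ K ⊆ stateInternal H d c i, K.card = n → ∀ lev : V → ℕ,
      TailFeasible (statePendent H d c i) K (fun v => d v - 1) lev →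
      ∑ j ∈ Finset.univ.filter (fun j : Fin q => i ≤ j ∧ (j : ℕ) < i + n), H.f μ (c j) ≤
        levelCost (statePendent H d c i) K (stateMu H μ c i) lev := by
  induction n with
  | zero =>
    intro i _ K _ hK lev _
    rw [Finset.filter_false_of_mem fun j _ => by omega, Finset.sum_empty]
    have h := stateMu_nonneg H hμ c i
    exact add_nonneg (Finset.sum_nonneg fun v _ => mul_nonneg (h v) (by positivity))
      (Finset.sum_nonneg fun v _ => mul_nonneg (h v) (by positivity))
  | succ n ih =>
    intro i hi K hK hcard lev hfeas
    obtain ⟨hdeg, hinj, -, -, hstar⟩ := hH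
    lift i to Fin q using by omega
    have hs := hstar i (by omega)
    have hle := minimalStar_le hmono hs
    have hsP := statePendent_succ hs
    have hsI := stateInternal_succ hs
    obtain ⟨hm, hm1, hLV, hmL, hLcard, hLd, -, -, hLmin⟩ := hs
    have hLP : H.children (c i) ⊆ statePendent H d c i := fun v hv =>
      Finset.mem_filter.2 ⟨hLV hv, hLd v hv⟩
    obtain ⟨-, hdc, hμc⟩ := state_eq_of_one_lt (T := H) (μ := μ) hm1
    have hfc : stateMu H μ c ((i : ℕ) + 1) (c i) = H.f μ (c i) := by
      rw [stateMu_succ, if_pos rfl]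
    have hfsum : stateMu H μ c ((i : ℕ) + 1) (c i) =
        stateMu H μ c i (c i) + ∑ v ∈ H.children (c i), stateMu H μ c i v := by
      rw [hfc, H.f_eq, hμc]
      congr 1
      refine Finset.sum_congr rfl fun v hv => (stateMu_eq_f hdeg ?_ (hLd v hv)).symm
      rintro rfl
      obtain ⟨h1, h2⟩ := DirTree.mem_children.1 hv
      exact h2 (H.parent_root.symm.trans h1)
    obtain ⟨K', lev', hK', hcard', hfeas', hcost⟩ :=
      exists_contract_star (ν := stateMu H μ c ((i : ℕ) + 1)) (disjoint_state H d c i)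
        (Finset.mem_filter.2 ⟨hm, hm1⟩) hle hLP (hLcard.trans (by rw [hdc]))
        (fun u hu w hw hwL => hLmin u hu w (Finset.mem_filter.1 hw).1
          (Finset.mem_filter.1 hw).2 hwL)
        (fun v _ => stateMu_nonneg H hμ c i v) hfsum
        (fun v hv => by rw [stateMu_succ, if_neg hv]) hK
        (Finset.card_pos.1 (by omega)) hfeas
    rw [← hsI] at hK'
    rw [← hsP] at hfeas' hcost
    have h := ih ((i : ℕ) + 1) (by omega) K' hK' (by omega) lev' hfeas'
    refine le_trans ?_ hcost
    have hset : (Finset.univ.filter fun j : Fin q => (i : ℕ) ≤ j ∧ (j : ℕ) < i + (n + 1)) =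
        insert i (Finset.univ.filter fun j : Fin q =>
          (i : ℕ) + 1 ≤ j ∧ (j : ℕ) < i + 1 + n) := by
      ext j
      simp only [Finset.mem_filter, Finset.mem_univ, true_and, Finset.mem_insert, Fin.ext_iff]
      omega
    rw [hset, Finset.sum_insert (by simp), hfc]
    linarith

lemma card_fvec (T : DirTree V) {μ : V → ℝ} {d : V → ℕ} (hT : memR T d) :
    Multiset.card (T.fvec μ) + 1 = (Finset.univ.filter fun v => 1 < d v).card := by
  have : (Finset.univ.filter fun m => 1 < T.deg m ∧ m ≠ T.root) =
      (Finset.univ.filter fun v => 1 < d v).erase T.root := by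
    ext v
    simp only [Finset.mem_filter, Finset.mem_univ, true_and, Finset.mem_erase, hT.2]
    exact and_comm
  rw [DirTree.fvec, Multiset.card_map, Finset.card_val, this,
    Finset.card_erase_add_one (by simpa using hT.1)]

/-- under degree-monotone weights, the vector of subordinate groups'
weights of a directed Huffman tree weakly majorizes that of every tree of `ℛ(μ,d)`. -/
theorem huffman_weakly_majorizes {V : Type} [Fintype V] [DecidableEq V]
    (μ : V → ℝ) (d : V → ℕ) (hgen : IsGenTuple μ d) (hmono : DegMonotone μ d)
    (H : DirTree V) (hH : IsHuffmanDir μ d H)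
    (T : DirTree V) (hT : memR T d) :
    WMaj (H.fvec μ) (T.fvec μ) := by
  obtain ⟨q, c, hseq⟩ := hH
  obtain ⟨hdeg, hinj, hint, hroot, -⟩ := id hseq
  have hcardI : (Finset.univ.filter fun v => 1 < d v).card = q := by
    have : (Finset.univ.filter fun v => 1 < d v) = Finset.univ.image c := by
      ext v
      simp [hint]
    rw [this, Finset.card_image_of_injective _ hinj, Finset.card_univ, Fintype.card_fin]
  have hq : 0 < q := hcardI ▸ hgen.one_le_internal
  have hHR : memR H d := ⟨(hint _).2 ⟨_, (hroot hq).symm⟩, hdeg⟩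
  have hcH := card_fvec H (μ := μ) hHR
  have hcT := card_fvec T (μ := μ) hT
  have key : ∀ k ≤ q - 1, ascSum (H.fvec μ) k ≤ ascSum (T.fvec μ) k := by
    intro k hk
    have hcard : k ≤ (Finset.univ.filter fun m => 1 < T.deg m ∧ m ≠ T.root).card := by
      rw [DirTree.fvec, Multiset.card_map, Finset.card_val] at hcT
      omega
    obtain ⟨K₀, hK₀, hK₀card, hK₀sum⟩ := exists_subset_ascSum _ (T.f μ) hcard
    obtain ⟨K, hK, hKcard, hclosed, hKsum⟩ := T.exists_closed_of_card hgen.nonneg hK₀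
    have hKmem : ∀ m ∈ K, 1 < d m ∧ m ≠ T.root := fun m hm => by
      have := hK hm
      rwa [Finset.mem_filter, hT.2, and_iff_right (Finset.mem_univ _)] at this
    have hP : statePendent H d c 0 = Finset.univ.filter fun v => d v = 1 := by
      ext v
      simp [statePendent, mem_stateV, stateD, usedCenters]
    have hI : stateInternal H d c 0 = Finset.univ.filter fun v => 1 < d v := by
      ext v
      simp [stateInternal, mem_stateV, stateD, usedCenters]
    have hM : stateMu H μ c 0 = μ := by
      funext v
      simp [stateMu, usedCenters]
    have hPK : Disjoint (Finset.univ.filter fun v => d v = 1) K :=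
      Finset.disjoint_left.2 fun v hv hvK => by
        have := (hKmem v hvK).1
        have := (Finset.mem_filter.1 hv).2
        omega
    have hfeas : TailFeasible (Finset.univ.filter fun v => d v = 1) K (fun v => d v - 1)
        (T.level K) := by
      refine DirTree.tailFeasible_level (fun m hm => ?_) fun m hm u hu => ?_
      · rw [← hT.2, DirTree.deg, if_neg (hKmem m hm).2, Nat.add_sub_cancel]
      · obtain ⟨h1, h2⟩ := DirTree.mem_children.1 hu
        have := hgen.deg_pos u
        by_cases hu1 : d u = 1
        · exact Finset.mem_union_left _ (by simpa using hu1)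
        · refine Finset.mem_union_right _ (hclosed m hm u hu ?_)
          simp only [Finset.mem_filter, Finset.mem_univ, true_and, hT.2]
          refine ⟨by omega, ?_⟩
          rintro rfl
          exact h2 (T.parent_root.symm.trans h1)
    have hlow := huffman_partial_sum_le hgen.nonneg hmono hseq k 0 (by omega) K
      (by rw [hI]; exact fun m hm => by simpa using (hKmem m hm).1) (hKcard.trans hK₀card)
      (T.level K) (by rw [hP]; exact hfeas)
    rw [hP, hM] at hlow
    have hlevel := DirTree.levelCost_level_le (T := T) hgen.nonneg hPK
    have hup : ascSum (H.fvec μ) k ≤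
        ∑ j ∈ Finset.univ.filter (fun j : Fin q => 0 ≤ (j : ℕ) ∧ (j : ℕ) < 0 + k),
          H.f μ (c j) := by
      set J := Finset.univ.filter fun j : Fin q => 0 ≤ (j : ℕ) ∧ (j : ℕ) < 0 + k with hJ
      have hJcard : (J.image c).card = k := by
        rw [Finset.card_image_of_injective _ hinj, hJ]
        simp only [Nat.zero_le, true_and, Nat.zero_add]
        rw [Fin.card_filter_val_lt, min_eq_right (by omega)]
      have hsub : J.image c ⊆ Finset.univ.filter fun m => 1 < H.deg m ∧ m ≠ H.root := by
        intro v hv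
        obtain ⟨j, hj, rfl⟩ := Finset.mem_image.1 hv
        have hjk : (j : ℕ) < 0 + k := (Finset.mem_filter.1 hj).2.2
        simp only [Finset.mem_filter, Finset.mem_univ, true_and, hdeg, hroot hq]
        refine ⟨(hint _).2 ⟨j, rfl⟩, fun h => ?_⟩
        have := congrArg Fin.val (hinj h)
        simp only at this
        omega
      have h := ascSum_le_sum (Multiset.map_le_map (f := H.f μ) (Finset.val_le_iff.2 hsub))
      rw [Multiset.card_map, Finset.card_val, hJcard] at h
      refine h.trans_eq ?_
      exact Finset.sum_image fun a _ b _ hab => hinj hab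
    calc ascSum (H.fvec μ) k ≤ _ := hup
      _ ≤ _ := hlow
      _ ≤ _ := hlevel
      _ ≤ _ := hKsum
      _ = ascSum (T.fvec μ) k := hK₀sum
  refine ⟨by omega, fun k => ?_⟩
  rcases le_total k (q - 1) with h | h
  · exact key k h
  · rw [ascSum_of_card_le (s := H.fvec μ) (by omega), ascSum_of_card_le (s := T.fvec μ) (by omega),
      show Multiset.card (H.fvec μ) = q - 1 by omega,
      show Multiset.card (T.fvec μ) = q - 1 by omega]
    exact key _ le_rfl
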